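/- Fix k ≥ 2 and suppose ⟨L_{2k−1}, L_{2k−2}⟩₁ ≠ 0. Then: (i) there exists a unique monic polynomial π_{2k,1} of degree 2k with ⟨π_{2k,1}, y^j⟩₁ = 0 for j = 0,…,2k−1, and it is given by π_{2k,1} = L_{2k} − (⟨L_{2k},L_{2k−2}⟩₁/⟨L_{2k−1},L_{2k−2}⟩₁)·L_{2k−1}; (ii) ⟨L_{2k}, L_{2k−1}⟩₁ = 0; (iii) a monic polynomial π of degree 2k+1 satisfies ⟨π, y^j⟩₁ = 0 for j = 0,…,2k−1 if and only if π = L_{2k+1} − (⟨L_{2k+1},L_{2k−2}⟩₁/⟨L_{2k−1},L_{2k−2}⟩₁)·L_{2k−1} + (⟨L_{2k+1},L_{2k−1}⟩₁/⟨L_{2k−1},L_{2k−2}⟩₁)·L_{2k−2} + c·π_{2k,1} for some constant c ∈ ℂ. -/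

import Mathlib

open MeasureTheory Polynomial Set

noncomputable section

/-- The weight `w(x) = e^{−Mx/2}·x^{(M−N−1)/2}·(t−x)^{−1/2}` on `(0,∞)`,
using the principal branch of the complex power. -/
def wC (M N : ℕ) (t : ℂ) (x : ℝ) : ℂ :=
  Complex.exp (-(M : ℂ) * x / 2) * (x : ℂ) ^ (((((M : ℝ) - N - 1) / 2 : ℝ)) : ℂ) *
    (t - x) ^ (-(1 / 2) : ℂ)

/-- The Laguerre weight `w₀(x) = x^{M−N}·e^{−Mx}`. -/
def w0R (M N : ℕ) (x : ℝ) : ℝ := x ^ (M - N) * Real.exp (-(M : ℝ) * x)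

/-- The skew product `⟨f,g⟩₁ = ∫₀^∞∫₀^∞ (1/2)·sgn(x−y)·f(x)·g(y)·w(x)·w(y) dy dx`. -/
def skew1 (M N : ℕ) (t : ℂ) (f g : Polynomial ℂ) : ℂ :=
  ∫ x in Ioi (0 : ℝ), ∫ y in Ioi (0 : ℝ),
    ((Real.sign (x - y) : ℝ) : ℂ) / 2 * f.eval (x : ℂ) * g.eval (y : ℂ) *
      wC M N t x * wC M N t y

/-- The inner product `⟨f,g⟩₂ = ∫₀^∞ f(x)·g(x)·w₀(x) dx`. -/
def inner2C (M N : ℕ) (f g : Polynomial ℂ) : ℂ :=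
  ∫ x in Ioi (0 : ℝ), f.eval (x : ℂ) * g.eval (x : ℂ) * (w0R M N x : ℂ)

/-- `IsLag M N L` says that `L n` is the monic degree-`n` orthogonal polynomial for the
weight `w₀` (the rescaled Laguerre polynomial). -/
def IsLag (M N : ℕ) (L : ℕ → Polynomial ℂ) : Prop :=
  ∀ n, (L n).Monic ∧ (L n).natDegree = n ∧
    ∀ j, j < n → inner2C M N (L n) (Polynomial.X ^ j) = 0

/-- The operator `T(q)(x) = x(t−x)q′(x) +
[(t−2x) − (M/2)x(t−x) + ((M−N−1)/2)(t−x) + x/2]·q(x)`,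
i.e. formally `T(q) = (d/dx)(q·x·(t−x)·w)/w`. -/
def Tq (M N : ℕ) (t : ℂ) (q : Polynomial ℂ) : Polynomial ℂ :=
  Polynomial.X * (Polynomial.C t - Polynomial.X) * Polynomial.derivative q +
    ((Polynomial.C t - 2 * Polynomial.X)
        - Polynomial.C ((M : ℂ) / 2) * (Polynomial.X * (Polynomial.C t - Polynomial.X))
        + Polynomial.C (((M : ℂ) - N - 1) / 2) * (Polynomial.C t - Polynomial.X)
        + Polynomial.C (1 / 2) * Polynomial.X) * q

/-- `ε(f)(x) = ∫₀^∞ (1/2)·sgn(x−y)·f(y) dy`. -/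
def epsC (f : ℝ → ℂ) (x : ℝ) : ℂ :=
  ∫ y in Ioi (0 : ℝ), ((Real.sign (x - y) : ℝ) : ℂ) / 2 * f y

/-- The squared norm `h_{n,0} = ∫₀^∞ L_n(x)²·w₀(x) dx`. -/
def hC (M N : ℕ) (L : ℕ → Polynomial ℂ) (n : ℕ) : ℂ :=
  ∫ x in Ioi (0 : ℝ), (L n).eval (x : ℂ) ^ 2 * (w0R M N x : ℂ)

end

theorem integrableOn_eval_mul_rpow_mul_exp (p : ℂ[X]) {s b : ℝ} (hs : 0 ≤ s) (hb : 0 < b) :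
    IntegrableOn (fun x : ℝ => p.eval (x : ℂ) * ((x ^ s * Real.exp (-b * x) : ℝ) : ℂ))
      (Ioi 0) := by
  induction p using Polynomial.induction_on' with
  | add p q hp hq =>
    simp only [eval_add, add_mul]
    exact hp.add hq
  | monomial n c =>
    have h : IntegrableOn (fun x : ℝ => x ^ (s + n) * Real.exp (-b * x ^ (1 : ℝ))) (Ioi 0) :=
      integrableOn_rpow_mul_exp_neg_mul_rpow (by linarith [(Nat.cast_nonneg n : (0 : ℝ) ≤ n)]) one_pos hb
    refine IntegrableOn.congr_fun (h.ofReal.const_mul c) (fun x hx => ?_) measurableSet_Ioi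
    have hx : 0 < x := hx
    simp only [eval_monomial, Real.rpow_one, Real.rpow_add hx, Real.rpow_natCast]
    simp only [Complex.coe_algebraMap]
    push_cast
    ring

theorem sub_ofReal_mem_slitPlane {t : ℂ} (ht : t.im ≠ 0) (x : ℝ) :
    t - x ∈ Complex.slitPlane :=
  Or.inr (by simpa using ht)

theorem norm_sub_ofReal_cpow_le {t : ℂ} (ht : t.im ≠ 0) (x : ℝ) :
    ‖(t - x) ^ (-(1 / 2) : ℂ)‖ ≤ |t.im| ^ (-(1 / 2) : ℝ) := by
  have h : (-(1 / 2) : ℂ) = ((-(1 / 2) : ℝ) : ℂ) := by push_cast; rfl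
  rw [h, Complex.norm_cpow_real]
  refine Real.rpow_le_rpow_of_nonpos (abs_pos.2 ht) ?_ (by norm_num)
  simpa using Complex.abs_im_le_norm (t - x)

theorem continuous_sub_ofReal_cpow {t : ℂ} (ht : t.im ≠ 0) (c : ℂ) :
    Continuous fun x : ℝ => (t - x) ^ c :=
  continuous_iff_continuousAt.2 fun x =>
    ContinuousAt.cpow (by fun_prop) continuousAt_const (sub_ofReal_mem_slitPlane ht x)

theorem wC_eq_ofReal_mul {M N : ℕ} (t : ℂ) {x : ℝ} (hx : 0 ≤ x) :
    wC M N t x = ((x ^ (((M : ℝ) - N - 1) / 2) * Real.exp (-((M : ℝ) / 2) * x) : ℝ) : ℂ) *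
      (t - x) ^ (-(1 / 2) : ℂ) := by
  rw [wC, ← Complex.ofReal_cpow hx]
  push_cast
  rw [mul_comm (Complex.exp _)]
  congr 4
  ring

theorem exponent_nonneg {M N : ℕ} (hNM : N < M) : 0 ≤ ((M : ℝ) - N - 1) / 2 := by
  have : (N : ℝ) + 1 ≤ M := by exact_mod_cast hNM
  linarith

theorem integrableOn_eval_mul_wC {M N : ℕ} (hNM : N < M) {t : ℂ} (ht : t.im ≠ 0) (p : ℂ[X]) :
    IntegrableOn (fun x : ℝ => p.eval (x : ℂ) * wC M N t x) (Ioi 0) := by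
  have hM : (0 : ℝ) < (M : ℝ) / 2 := by
    have : (0 : ℝ) < M := by exact_mod_cast (Nat.zero_le N).trans_lt hNM
    linarith
  have h := (integrableOn_eval_mul_rpow_mul_exp p (exponent_nonneg hNM) hM).mul_bdd
    (continuous_sub_ofReal_cpow ht _).aestronglyMeasurable
    (Filter.Eventually.of_forall (norm_sub_ofReal_cpow_le ht))
  refine IntegrableOn.congr_fun h (fun x hx => ?_) measurableSet_Ioi
  simp only [wC_eq_ofReal_mul t (le_of_lt hx)]
  ring

theorem integrableOn_eval_mul_w0R {M N : ℕ} (hNM : N < M) (p : ℂ[X]) :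
    IntegrableOn (fun x : ℝ => p.eval (x : ℂ) * (w0R M N x : ℂ)) (Ioi 0) := by
  have hM : (0 : ℝ) < (M : ℝ) := by exact_mod_cast (Nat.zero_le N).trans_lt hNM
  have h := integrableOn_eval_mul_rpow_mul_exp p (Nat.cast_nonneg (M - N)) hM
  simpa only [Real.rpow_natCast, w0R] using h

theorem measurable_real_sign : Measurable Real.sign :=
  Measurable.ite measurableSet_Iio measurable_const
    (Measurable.ite measurableSet_Ioi measurable_const measurable_const)

theorem norm_sign_div_two_le (x : ℝ) : ‖((Real.sign x : ℝ) : ℂ) / 2‖ ≤ 1 := by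
  rcases Real.sign_apply_eq x with h | h | h <;> simp [h] <;> norm_num

theorem integrable_skew1_integrand {M N : ℕ} (hNM : N < M) {t : ℂ} (ht : t.im ≠ 0)
    (f g : ℂ[X]) :
    Integrable (fun z : ℝ × ℝ => ((Real.sign (z.1 - z.2) : ℝ) : ℂ) / 2 * f.eval (z.1 : ℂ) *
      g.eval (z.2 : ℂ) * wC M N t z.1 * wC M N t z.2)
      ((volume.restrict (Ioi 0)).prod (volume.restrict (Ioi 0))) := by
  have hm : Measurable fun z : ℝ × ℝ => ((Real.sign (z.1 - z.2) : ℝ) : ℂ) / 2 :=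
    (Complex.measurable_ofReal.comp
      (measurable_real_sign.comp (measurable_fst.sub measurable_snd))).div_const 2
  have h := ((integrableOn_eval_mul_wC hNM ht f).mul_prod
    (integrableOn_eval_mul_wC hNM ht g)).bdd_mul hm.aestronglyMeasurable
    (Filter.Eventually.of_forall fun z => norm_sign_div_two_le (z.1 - z.2))
  refine h.congr (Filter.Eventually.of_forall fun z => ?_)
  ring

theorem skew1_eq_integral_prod {M N : ℕ} (hNM : N < M) {t : ℂ} (ht : t.im ≠ 0) (f g : ℂ[X]) :
    skew1 M N t f g = ∫ z : ℝ × ℝ, ((Real.sign (z.1 - z.2) : ℝ) : ℂ) / 2 * f.eval (z.1 : ℂ) *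
      g.eval (z.2 : ℂ) * wC M N t z.1 * wC M N t z.2
      ∂((volume.restrict (Ioi 0)).prod (volume.restrict (Ioi 0))) :=
  (integral_prod _ (integrable_skew1_integrand hNM ht f g)).symm

theorem skew1_swap {M N : ℕ} (hNM : N < M) {t : ℂ} (ht : t.im ≠ 0) (f g : ℂ[X]) :
    skew1 M N t f g = -skew1 M N t g f := by
  unfold skew1
  rw [integral_integral_swap (integrable_skew1_integrand hNM ht f g), ← integral_neg]
  congr 1 with x
  rw [← integral_neg]
  congr 1 with y
  rw [← neg_sub x y, Real.sign_neg]
  push_cast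
  ring

theorem skew1_add_left {M N : ℕ} (hNM : N < M) {t : ℂ} (ht : t.im ≠ 0) (f₁ f₂ g : ℂ[X]) :
    skew1 M N t (f₁ + f₂) g = skew1 M N t f₁ g + skew1 M N t f₂ g := by
  simp only [skew1_eq_integral_prod hNM ht]
  rw [← integral_add (integrable_skew1_integrand hNM ht f₁ g)
    (integrable_skew1_integrand hNM ht f₂ g)]
  congr 1 with z
  rw [eval_add]
  ring

theorem skew1_smul_left {M N : ℕ} (t c : ℂ) (f g : ℂ[X]) :
    skew1 M N t (c • f) g = c * skew1 M N t f g := by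
  unfold skew1
  simp only [← integral_const_mul]
  congr 1 with x
  congr 1 with y
  rw [eval_smul, smul_eq_mul]
  ring

/-- The skew product `skew1` as a bilinear form. -/
noncomputable def skewForm {M N : ℕ} (hNM : N < M) {t : ℂ} (ht : t.im ≠ 0) : LinearMap.BilinForm ℂ ℂ[X] :=
  LinearMap.mk₂ ℂ (skew1 M N t) (skew1_add_left hNM ht) (skew1_smul_left t)
    (fun f g₁ g₂ => by
      rw [skew1_swap hNM ht, skew1_add_left hNM ht, skew1_swap hNM ht f g₁,
        skew1_swap hNM ht f g₂]
      ring)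
    (fun c f g => by
      rw [skew1_swap hNM ht, skew1_smul_left, skew1_swap hNM ht f g, smul_eq_mul]
      ring)

/-- The inner product `inner2C` as a bilinear form. -/
noncomputable def innerForm {M N : ℕ} (hNM : N < M) : LinearMap.BilinForm ℂ ℂ[X] :=
  have hadd (f₁ f₂ g : ℂ[X]) : inner2C M N (f₁ + f₂) g = inner2C M N f₁ g + inner2C M N f₂ g := by
    have hi (f : ℂ[X]) := integrableOn_eval_mul_w0R hNM (f * g)
    simp only [eval_mul] at hi
    unfold inner2C
    rw [← integral_add (hi f₁) (hi f₂)]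
    congr 1 with x
    rw [eval_add]
    ring
  have hsmul (c : ℂ) (f g : ℂ[X]) : inner2C M N (c • f) g = c • inner2C M N f g := by
    unfold inner2C
    rw [← integral_smul]
    congr 1 with x
    simp only [eval_smul, smul_eq_mul]
    ring
  have hswap (f g : ℂ[X]) : inner2C M N f g = inner2C M N g f := by
    unfold inner2C
    congr 1 with x
    ring
  LinearMap.mk₂ ℂ (inner2C M N) hadd hsmul
    (fun f g₁ g₂ => by rw [hswap, hadd, hswap f, hswap f])
    (fun c f g => by rw [hswap, hsmul, hswap f])

/-- The inner product against `w₀` is nondegenerate: `f` is recovered as zero by testing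
against its complex conjugate. -/
theorem eq_zero_of_inner2C_conj_eq_zero {M N : ℕ} (hNM : N < M) {f : ℂ[X]}
    (h : inner2C M N f (f.map (starRingEnd ℂ)) = 0) : f = 0 := by
  have hev (x : ℝ) : (f.map (starRingEnd ℂ)).eval (x : ℂ) = starRingEnd ℂ (f.eval (x : ℂ)) := by
    have := eval_map_apply (starRingEnd ℂ) (x : ℂ) (p := f)
    simpa using this
  have hint := integrableOn_eval_mul_w0R hNM (f * f.map (starRingEnd ℂ))
  have hpt (x : ℝ) : f.eval (x : ℂ) * (f.map (starRingEnd ℂ)).eval (x : ℂ) * (w0R M N x : ℂ) =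
      ((Complex.normSq (f.eval (x : ℂ)) * w0R M N x : ℝ) : ℂ) := by
    rw [hev, Complex.mul_conj]
    push_cast
    rfl
  simp only [eval_mul, hpt] at hint
  simp only [inner2C, hpt, integral_complex_ofReal, Complex.ofReal_eq_zero] at h
  have hint' : IntegrableOn (fun x : ℝ => Complex.normSq (f.eval (x : ℂ)) * w0R M N x) (Ioi 0) := by
    simpa [IntegrableOn] using hint.re
  have hw {x : ℝ} (hx : 0 < x) : 0 < w0R M N x := by unfold w0R; positivity
  have hae := (setIntegral_eq_zero_iff_of_nonneg_ae
    ((ae_restrict_mem measurableSet_Ioi).mono fun x hx =>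
      mul_nonneg (Complex.normSq_nonneg _) (hw hx).le) hint').1 h
  by_contra hf
  have hroots : {x : ℝ | f.eval (x : ℂ) = 0}.Finite :=
    ((f.rootSet_finite ℂ).preimage Complex.ofReal_injective.injOn).subset fun x hx => by
      simpa [mem_rootSet, hf] using hx
  have hzero : ∀ᵐ x : ℝ ∂(volume.restrict (Ioi (0 : ℝ))), f.eval (x : ℂ) = 0 := by
    filter_upwards [hae, ae_restrict_mem measurableSet_Ioi] with x hx hx0
    simpa [(hw hx0).ne'] using hx
  have hne : ∀ᵐ x : ℝ ∂(volume.restrict (Ioi (0 : ℝ))), f.eval (x : ℂ) ≠ 0 :=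
    ae_restrict_of_ae (measure_eq_zero_iff_ae_notMem.1 (hroots.measure_zero volume))
  have hfalse : ∀ᵐ _ ∂(volume.restrict (Ioi (0 : ℝ))), False := by
    filter_upwards [hzero, hne] with x h₁ h₂ using h₂ h₁
  rw [Filter.eventually_false_iff_eq_bot, ae_eq_bot, Measure.restrict_eq_zero] at hfalse
  simp at hfalse

theorem hasDerivAt_eval_mul_wC {M N : ℕ} {t : ℂ} (ht : t.im ≠ 0) (q : ℂ[X]) {x : ℝ}
    (hx : 0 < x) :
    HasDerivAt (fun y : ℝ => (q * (X * (C t - X))).eval (y : ℂ) * wC M N t y)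
      ((Tq M N t q).eval (x : ℂ) * wC M N t x) x := by
  have hx0 : (x : ℂ) ≠ 0 := by exact_mod_cast hx.ne'
  have htx : t - x ≠ 0 := Complex.slitPlane_ne_zero (sub_ofReal_mem_slitPlane ht x)
  have hexp : HasDerivAt (fun z : ℂ => Complex.exp (-(M : ℂ) * z / 2))
      (Complex.exp (-(M : ℂ) * x / 2) * (-(M : ℂ) / 2)) (x : ℂ) := by
    simpa using (((hasDerivAt_id (x : ℂ)).const_mul (-(M : ℂ))).div_const 2).cexp
  have hpow := (hasDerivAt_id (x : ℂ)).cpow_const (c := ((((M : ℝ) - N - 1) / 2 : ℝ) : ℂ))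
    (Complex.ofReal_mem_slitPlane.2 hx)
  have hsub := ((hasDerivAt_id (x : ℂ)).const_sub t).cpow_const (c := (-(1 / 2) : ℂ))
    (sub_ofReal_mem_slitPlane ht x)
  have h := (((q * (X * (C t - X))).hasDerivAt (x : ℂ)).mul ((hexp.mul hpow).mul hsub)).comp_ofReal
  refine h.congr_deriv ?_
  simp only [id, Pi.mul_apply, Complex.cpow_sub _ _ hx0, Complex.cpow_sub _ _ htx, Complex.cpow_one, wC, Tq]
  simp only [derivative_mul, derivative_sub, derivative_C, derivative_X, eval_add, eval_mul,
    eval_sub, eval_X, eval_C, eval_one, eval_zero, eval_ofNat]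
  generalize (x : ℂ) ^ (_ : ℂ) = u, (t - x) ^ (_ : ℂ) = v
  push_cast
  field_simp
  ring

theorem wC_sq_mul {M N : ℕ} (hNM : N < M) {t : ℂ} (ht : t.im ≠ 0) {x : ℝ} (hx : 0 < x) :
    x * (t - x) * (wC M N t x * wC M N t x) = (w0R M N x : ℂ) := by
  have htx : t - x ≠ 0 := Complex.slitPlane_ne_zero (sub_ofReal_mem_slitPlane ht x)
  have hsqrt : (t - x) * ((t - x) ^ (-(1 / 2) : ℂ) * (t - x) ^ (-(1 / 2) : ℂ)) = 1 := by
    rw [← Complex.cpow_add _ _ htx]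
    norm_num [Complex.cpow_neg_one, htx]
  have hexp : Real.exp (-((M : ℝ) / 2) * x) * Real.exp (-((M : ℝ) / 2) * x) =
      Real.exp (-(M : ℝ) * x) := by
    rw [← Real.exp_add]
    ring_nf
  have hpow : x * (x ^ (((M : ℝ) - N - 1) / 2) * x ^ (((M : ℝ) - N - 1) / 2)) = x ^ (M - N) := by
    rw [← Real.rpow_add hx, ← Real.rpow_natCast, Nat.cast_sub hNM.le]
    nth_rw 1 [← Real.rpow_one x]
    rw [← Real.rpow_add hx]
    ring_nf
  rw [wC_eq_ofReal_mul t hx.le, w0R, ← hexp, ← hpow]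
  push_cast
  linear_combination (x * ((x ^ (((M : ℝ) - N - 1) / 2) : ℝ) : ℂ) ^ 2 *
    Complex.exp (-((M : ℂ) / 2) * x) ^ 2) * hsqrt

theorem epsC_Tq_mul_wC {M N : ℕ} (hNM : N < M) {t : ℂ} (ht : t.im ≠ 0) (q : ℂ[X]) {x : ℝ}
    (hx : 0 < x) :
    epsC (fun y => (Tq M N t q).eval (y : ℂ) * wC M N t y) x =
      (q * (X * (C t - X))).eval (x : ℂ) * wC M N t x := by
  set F : ℝ → ℂ := fun y => (q * (X * (C t - X))).eval (y : ℂ) * wC M N t y with hF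
  set F' : ℝ → ℂ := fun y => (Tq M N t q).eval (y : ℂ) * wC M N t y
  have hderiv {y : ℝ} (hy : 0 < y) : HasDerivAt F (F' y) y := hasDerivAt_eval_mul_wC ht q hy
  have hint : IntegrableOn F (Ioi 0) := integrableOn_eval_mul_wC hNM ht _
  have hint' : IntegrableOn F' (Ioi 0) := integrableOn_eval_mul_wC hNM ht _
  have hlim := tendsto_zero_of_hasDerivAt_of_integrableOn_Ioi (fun y hy => hderiv hy) hint' hint
  have hcont : ContinuousWithinAt F (Ici 0) 0 := by
    have hG : Continuous fun y : ℝ => (q * (X * (C t - X))).eval (y : ℂ) *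
        (((y ^ (((M : ℝ) - N - 1) / 2) * Real.exp (-((M : ℝ) / 2) * y) : ℝ) : ℂ) *
          (t - y) ^ (-(1 / 2) : ℂ)) := by
      have h₁ := Real.continuous_rpow_const (exponent_nonneg hNM)
      have h₂ := continuous_sub_ofReal_cpow ht (-(1 / 2) : ℂ)
      have h₃ : Continuous fun y : ℝ => (q * (X * (C t - X))).eval (y : ℂ) :=
        (Polynomial.continuous _).comp Complex.continuous_ofReal
      exact h₃.mul ((Complex.continuous_ofReal.comp (h₁.mul (by fun_prop))).mul h₂)
    refine hG.continuousWithinAt.congr (fun y hy => ?_) ?_ <;> simp only [hF]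
    · rw [wC_eq_ofReal_mul t hy]
    · rw [wC_eq_ofReal_mul t le_rfl]
  have hF0 : F 0 = 0 := by simp [hF]
  have hall : ∫ y in Ioi 0, F' y = 0 := by
    rw [integral_Ioi_of_hasDerivAt_of_tendsto hcont (fun y hy => hderiv hy) hint' hlim, hF0,
      sub_zero]
  have htail : ∫ y in Ioi x, F' y = -F x := by
    rw [integral_Ioi_of_hasDerivAt_of_tendsto' (fun y hy => hderiv (hx.trans_le hy))
      (hint'.mono_set (Ioi_subset_Ioi hx.le)) hlim, zero_sub]
  have hsplit (G : ℝ → ℂ) (hG : IntegrableOn G (Ioi 0)) :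
      ∫ y in Ioi 0, G y = (∫ y in Ioo 0 x, G y) + ∫ y in Ioi x, G y := by
    rw [← Ioc_union_Ioi_eq_Ioi hx.le, setIntegral_union
      (Ioc_disjoint_Ioi le_rfl) measurableSet_Ioi
      (hG.mono_set Ioc_subset_Ioi_self) (hG.mono_set (Ioi_subset_Ioi hx.le)),
      integral_Ioc_eq_integral_Ioo]
  have hsign : IntegrableOn (fun y => ((Real.sign (x - y) : ℝ) : ℂ) / 2 * F' y) (Ioi 0) :=
    Integrable.bdd_mul hint' ((Complex.measurable_ofReal.comp
      (measurable_real_sign.comp (measurable_const.sub measurable_id))).div_const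
        2).aestronglyMeasurable
      (Filter.Eventually.of_forall fun y => norm_sign_div_two_le (x - y))
  have hleft : ∫ y in Ioo 0 x, ((Real.sign (x - y) : ℝ) : ℂ) / 2 * F' y =
      1 / 2 * ∫ y in Ioo 0 x, F' y := by
    rw [← integral_const_mul]
    refine setIntegral_congr_fun measurableSet_Ioo fun y hy => ?_
    simp [Real.sign_of_pos (sub_pos.2 hy.2)]
  have hright : ∫ y in Ioi x, ((Real.sign (x - y) : ℝ) : ℂ) / 2 * F' y =
      -1 / 2 * ∫ y in Ioi x, F' y := by
    rw [← integral_const_mul]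
    refine setIntegral_congr_fun measurableSet_Ioi fun y hy => ?_
    simp [Real.sign_of_neg (sub_neg.2 hy)]
  have hIoo := hsplit F' hint'
  rw [hall, htail] at hIoo
  rw [epsC, hsplit _ hsign, hleft, hright, htail]
  linear_combination -(1 / 2) * hIoo

theorem skew1_Tq {M N : ℕ} (hNM : N < M) {t : ℂ} (ht : t.im ≠ 0) (f q : ℂ[X]) :
    skew1 M N t f (Tq M N t q) = inner2C M N f q := by
  unfold skew1 inner2C
  refine setIntegral_congr_fun measurableSet_Ioi fun x hx => ?_
  have heps := epsC_Tq_mul_wC hNM ht q hx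
  have hw := wC_sq_mul hNM ht hx
  calc _ = f.eval (x : ℂ) * wC M N t x *
        epsC (fun y => (Tq M N t q).eval (y : ℂ) * wC M N t y) x := by
        rw [epsC, ← integral_const_mul]
        congr 1 with y
        ring
    _ = _ := by
        rw [heps]
        simp only [eval_mul, eval_sub, eval_X, eval_C]
        linear_combination (f.eval (x : ℂ) * q.eval (x : ℂ)) * hw

theorem skewForm_apply {M N : ℕ} (hNM : N < M) {t : ℂ} (ht : t.im ≠ 0) (f g : ℂ[X]) :
    skewForm hNM ht f g = skew1 M N t f g := rfl

theorem innerForm_apply {M N : ℕ} (hNM : N < M) (f g : ℂ[X]) :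
    innerForm hNM f g = inner2C M N f g := rfl

theorem skewForm_swap {M N : ℕ} (hNM : N < M) {t : ℂ} (ht : t.im ≠ 0) (f g : ℂ[X]) :
    skewForm hNM ht f g = -skewForm hNM ht g f :=
  skew1_swap hNM ht f g

theorem skewForm_self {M N : ℕ} (hNM : N < M) {t : ℂ} (ht : t.im ≠ 0) (f : ℂ[X]) :
    skewForm hNM ht f f = 0 :=
  self_eq_neg.1 (skewForm_swap hNM ht f f)

/-- The operator `Tq` as a linear map. -/
noncomputable def linTq (M N : ℕ) (t : ℂ) : ℂ[X] →ₗ[ℂ] ℂ[X] where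
  toFun := Tq M N t
  map_add' p q := by
    simp only [Tq, derivative_add]
    ring
  map_smul' c p := by
    simp only [Tq, smul_eq_C_mul, derivative_C_mul, RingHom.id_apply]
    ring

theorem skewForm_linTq {M N : ℕ} (hNM : N < M) {t : ℂ} (ht : t.im ≠ 0) (f q : ℂ[X]) :
    skewForm hNM ht f (linTq M N t q) = innerForm hNM f q :=
  skew1_Tq hNM ht f q

theorem map_conj_mem_degreeLT {f : ℂ[X]} {n : ℕ} (hf : f ∈ degreeLT ℂ n) :
    f.map (starRingEnd ℂ) ∈ degreeLT ℂ n := by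
  rw [mem_degreeLT] at hf ⊢
  exact degree_map_le.trans_lt hf

theorem eq_zero_of_innerForm_degreeLT {M N : ℕ} (hNM : N < M) {f : ℂ[X]} {n : ℕ}
    (hf : f ∈ degreeLT ℂ n) (h : ∀ q ∈ degreeLT ℂ n, innerForm hNM f q = 0) : f = 0 :=
  eq_zero_of_inner2C_conj_eq_zero hNM (h _ (map_conj_mem_degreeLT hf))

theorem linTq_mem_degreeLT (M N : ℕ) (t : ℂ) {q : ℂ[X]} {n : ℕ} (hq : q ∈ degreeLT ℂ n) :
    linTq M N t q ∈ degreeLT ℂ (n + 2) := by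
  have hbound : (Tq M N t q).natDegree ≤ q.natDegree + 2 := by
    have hd : (derivative q).natDegree ≤ q.natDegree :=
      (natDegree_derivative_le q).trans (Nat.sub_le _ _)
    have h₁ : (X * (C t - X) : ℂ[X]).natDegree ≤ 2 := by compute_degree
    have h₂ : ((C t - 2 * X) - C ((M : ℂ) / 2) * (X * (C t - X))
        + C (((M : ℂ) - N - 1) / 2) * (C t - X) + C (1 / 2) * X : ℂ[X]).natDegree ≤ 2 := by
      compute_degree
    refine natDegree_add_le_of_degree_le ?_ ?_
    · exact natDegree_mul_le.trans (by omega)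
    · exact natDegree_mul_le.trans (by omega)
  rcases eq_or_ne q 0 with rfl | hq0
  · simp
  · rw [mem_degreeLT] at hq ⊢
    rw [degree_eq_natDegree hq0, Nat.cast_lt] at hq
    refine degree_le_natDegree.trans_lt ?_
    rw [Nat.cast_lt]
    exact lt_of_le_of_lt hbound (by omega)

theorem linTq_eq_zero {M N : ℕ} (hNM : N < M) {t : ℂ} (ht : t.im ≠ 0) {q : ℂ[X]}
    (h : linTq M N t q = 0) : q = 0 := by
  have hswap (f : ℂ[X]) : innerForm hNM q f = 0 := by
    rw [← map_zero (skewForm hNM ht f), ← h, skewForm_linTq, innerForm_apply, innerForm_apply,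
      inner2C, inner2C]
    congr 1 with x
    ring
  exact eq_zero_of_inner2C_conj_eq_zero hNM (hswap _)

theorem forall_degreeLT_iff_forall_X_pow (φ : ℂ[X] →ₗ[ℂ] ℂ) (n : ℕ) :
    (∀ q ∈ degreeLT ℂ n, φ q = 0) ↔ ∀ j < n, φ (X ^ j) = 0 := by
  refine ⟨fun h j hj => h _ (mem_degreeLT.2 ?_), fun h q hq => ?_⟩
  · rw [degree_X_pow]
    exact_mod_cast hj
  · have hle : degreeLT ℂ n ≤ LinearMap.ker φ := by
      rw [degreeLT_eq_span_X_pow, Submodule.span_le]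
      intro p hp
      simp only [Finset.coe_image, Set.mem_image, Finset.coe_range, Set.mem_Iio] at hp
      obtain ⟨j, hj, rfl⟩ := hp
      exact h j hj
    exact hle hq

theorem IsLag.innerForm_eq_zero {M N : ℕ} (hNM : N < M) {L : ℕ → ℂ[X]} (hL : IsLag M N L)
    {n : ℕ} {q : ℂ[X]} (hq : q ∈ degreeLT ℂ n) : innerForm hNM (L n) q = 0 :=
  (forall_degreeLT_iff_forall_X_pow (innerForm hNM (L n)) n).2 (hL n).2.2 q hq

theorem IsLag.mem_degreeLT {M N : ℕ} {L : ℕ → ℂ[X]} (hL : IsLag M N L) {m n : ℕ}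
    (h : n < m) : L n ∈ degreeLT ℂ m := by
  rw [Polynomial.mem_degreeLT, degree_eq_natDegree (hL n).1.ne_zero, (hL n).2.1]
  exact_mod_cast h

theorem sub_coeff_smul_mem_degreeLT {n : ℕ} {p r : ℂ[X]} (hp : p ∈ degreeLT ℂ (n + 1))
    (hr : r.Monic) (hrn : r.natDegree = n) : p - p.coeff n • r ∈ degreeLT ℂ n := by
  rw [mem_degreeLT] at hp ⊢
  rw [degree_lt_iff_coeff_zero] at hp ⊢
  intro m hm
  rcases hm.eq_or_lt with rfl | hm
  · have : r.coeff n = 1 := by rw [← hrn]; exact hr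
    simp [this]
  · simp [hp m hm, coeff_eq_zero_of_natDegree_lt (hrn.trans_lt hm)]

theorem degreeLT_le {m n : ℕ} (h : m ≤ n) : degreeLT ℂ m ≤ degreeLT ℂ n := fun p hp => by
  rw [mem_degreeLT] at hp ⊢
  exact hp.trans_le (by exact_mod_cast h)

/-- A polynomial of degree below `m + d` that is orthogonal to all polynomials of degree below
`m` is a combination of `L_m, …, L_{m+d-1}`. -/
theorem IsLag.exists_eq_sum {M N : ℕ} (hNM : N < M) {L : ℕ → ℂ[X]} (hL : IsLag M N L) {m : ℕ}
    (d : ℕ) {p : ℂ[X]} (hp : p ∈ degreeLT ℂ (m + d))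
    (horth : ∀ q ∈ degreeLT ℂ m, innerForm hNM p q = 0) :
    ∃ c : ℕ → ℂ, p = ∑ i ∈ Finset.range d, c i • L (m + i) := by
  induction d generalizing p with
  | zero => exact ⟨0, by simpa using eq_zero_of_innerForm_degreeLT hNM hp horth⟩
  | succ d ih =>
    obtain ⟨c, hc⟩ := ih
      (sub_coeff_smul_mem_degreeLT hp (hL (m + d)).1 (hL (m + d)).2.1) fun q hq => by
        rw [map_sub, map_smul, LinearMap.sub_apply, LinearMap.smul_apply, horth q hq,
          hL.innerForm_eq_zero hNM (degreeLT_le (Nat.le_add_right m d) hq), smul_zero, sub_zero]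
    refine ⟨Function.update c d (p.coeff (m + d)), ?_⟩
    rw [Finset.sum_range_succ, Function.update_self, ← sub_eq_iff_eq_add, hc]
    refine Finset.sum_congr rfl fun i hi => ?_
    rw [Function.update_of_ne (Finset.mem_range.1 hi).ne]

/-- A skew-symmetric bilinear form on an odd-dimensional space is degenerate. -/
theorem not_separatingLeft_of_skew_of_odd {V ι : Type*} [AddCommGroup V] [Module ℂ V]
    [Fintype ι] [DecidableEq ι] (b : Module.Basis ι ℂ V) (hι : Odd (Fintype.card ι))
    {B : LinearMap.BilinForm ℂ V} (hB : ∀ x y, B x y = -B y x) : ¬B.SeparatingLeft := by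
  rw [LinearMap.separatingLeft_iff_det_ne_zero b, not_not]
  set A := LinearMap.toMatrix₂ b b B
  have hA : A.transpose = -A := by
    ext i j
    simp only [A, Matrix.transpose_apply, Matrix.neg_apply, LinearMap.toMatrix₂_apply]
    exact hB _ _
  have hdet := congrArg Matrix.det hA
  rw [Matrix.det_transpose, Matrix.det_neg, hι.neg_one_pow, neg_one_mul] at hdet
  exact self_eq_neg.1 hdet

theorem IsLag.skewForm_linTq_eq_zero {M N : ℕ} (hNM : N < M) {t : ℂ} (ht : t.im ≠ 0)
    {L : ℕ → ℂ[X]} (hL : IsLag M N L) {n : ℕ} {q : ℂ[X]} (hq : q ∈ degreeLT ℂ n) :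
    skewForm hNM ht (L n) (linTq M N t q) = 0 := by
  rw [skewForm_linTq, hL.innerForm_eq_zero hNM hq]

/-- The space `T(𝒫_{<n})` has odd dimension, so it meets its own skew complement, which lies in
the span of `L_{n+1}` and `L_n`. -/
theorem IsLag.skewForm_succ_eq_zero {M N : ℕ} (hNM : N < M) {t : ℂ} (ht : t.im ≠ 0)
    {L : ℕ → ℂ[X]} (hL : IsLag M N L) {n : ℕ} (hn : Odd n) :
    skewForm hNM ht (L (n + 1)) (L n) = 0 := by
  set T := linTq M N t
  set P := degreeLT ℂ n
  have hdeg := not_separatingLeft_of_skew_of_odd (degreeLT.basis ℂ n) (by simpa using hn)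
    (B := (skewForm hNM ht).compl₁₂ (T.comp P.subtype) (T.comp P.subtype))
    (fun x y => skewForm_swap hNM ht _ _)
  simp only [LinearMap.SeparatingLeft, not_forall] at hdeg
  obtain ⟨⟨q, hq⟩, horth, hq0⟩ := hdeg
  have hq0 : q ≠ 0 := fun h => hq0 (Subtype.ext h)
  have horth' : ∀ r ∈ P, innerForm hNM (T q) r = 0 := fun r hr => by
    rw [← skewForm_linTq hNM ht]
    exact horth ⟨r, hr⟩
  obtain ⟨c, hc⟩ := hL.exists_eq_sum hNM 2 (linTq_mem_degreeLT M N t hq) horth'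
  simp only [Finset.sum_range_succ, Finset.sum_range_zero, zero_add, add_zero] at hc
  have h₁ := hL.skewForm_linTq_eq_zero hNM ht hq
  have h₂ := hL.skewForm_linTq_eq_zero hNM ht (degreeLT_le n.le_succ hq)
  rw [hc, map_add, map_smul, map_smul, skewForm_self, smul_zero, smul_eq_mul] at h₁ h₂
  rw [zero_add, skewForm_swap, mul_neg, neg_eq_zero] at h₁
  rw [add_zero] at h₂
  by_contra hne
  have hc0 : c 0 = 0 := (mul_eq_zero.1 h₂).resolve_right hne
  have hc1 : c 1 = 0 := (mul_eq_zero.1 h₁).resolve_right hne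
  rw [hc0, hc1, zero_smul, zero_smul, add_zero] at hc
  exact hq0 (linTq_eq_zero hNM ht hc)

theorem IsLag.exists_decomposition {M N : ℕ} (hNM : N < M) {t : ℂ} (ht : t.im ≠ 0)
    {L : ℕ → ℂ[X]} (hL : IsLag M N L) {m : ℕ} (hne : skewForm hNM ht (L (m + 1)) (L m) ≠ 0)
    {p : ℂ[X]} (hp : p ∈ degreeLT ℂ (m + 2)) :
    ∃ q ∈ degreeLT ℂ m, ∃ a b : ℂ, p = linTq M N t q + a • L (m + 1) + b • L m := by
  set T := linTq M N t
  let Φ : (degreeLT ℂ m × ℂ × ℂ) →ₗ[ℂ] degreeLT ℂ (m + 2) :=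
    LinearMap.codRestrict _ ((T.comp (degreeLT ℂ m).subtype).coprod
      ((LinearMap.toSpanSingleton ℂ _ (L (m + 1))).coprod
        (LinearMap.toSpanSingleton ℂ _ (L m)))) fun z =>
      add_mem (linTq_mem_degreeLT M N t z.1.2)
        (add_mem (Submodule.smul_mem _ _ (hL.mem_degreeLT (by omega)))
          (Submodule.smul_mem _ _ (hL.mem_degreeLT (by omega))))
  have hΦ (z) : (Φ z : ℂ[X]) = T z.1 + (z.2.1 • L (m + 1) + z.2.2 • L m) := rfl
  have hinj : Function.Injective Φ := by
    rw [← LinearMap.ker_eq_bot, LinearMap.ker_eq_bot']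
    rintro ⟨⟨q, hq⟩, a, b⟩ hz
    have hz : T q + (a • L (m + 1) + b • L m) = 0 := congrArg Subtype.val hz
    have h₁ := congrArg (skewForm hNM ht (L (m + 1))) hz
    have h₂ := congrArg (skewForm hNM ht (L m)) hz
    rw [map_add, map_add, map_smul, map_smul, map_zero, skewForm_self, smul_zero,
      smul_eq_mul] at h₁ h₂
    rw [hL.skewForm_linTq_eq_zero hNM ht (degreeLT_le m.le_succ hq), zero_add, zero_add] at h₁
    rw [hL.skewForm_linTq_eq_zero hNM ht hq, add_zero, zero_add, skewForm_swap, mul_neg,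
      neg_eq_zero] at h₂
    have hb : b = 0 := (mul_eq_zero.1 h₁).resolve_right hne
    have ha : a = 0 := (mul_eq_zero.1 h₂).resolve_right hne
    subst ha hb
    rw [zero_smul, zero_smul, add_zero, add_zero] at hz
    have hq0 := linTq_eq_zero hNM ht hz
    subst hq0
    rfl
  have : FiniteDimensional ℂ (degreeLT ℂ m) := (degreeLT.basis ℂ m).finiteDimensional_of_finite
  have : FiniteDimensional ℂ (degreeLT ℂ (m + 2)) :=
    (degreeLT.basis ℂ (m + 2)).finiteDimensional_of_finite
  have hrank : Module.finrank ℂ (degreeLT ℂ m × ℂ × ℂ) =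
      Module.finrank ℂ (degreeLT ℂ (m + 2)) := by
    simp [Module.finrank_eq_card_basis (degreeLT.basis ℂ m),
      Module.finrank_eq_card_basis (degreeLT.basis ℂ (m + 2))]
  obtain ⟨z, hz⟩ := (LinearMap.injective_iff_surjective_of_finrank_eq_finrank hrank).1 hinj ⟨p, hp⟩
  refine ⟨z.1, z.1.2, z.2.1, z.2.2, ?_⟩
  rw [add_assoc, ← hΦ, hz]

theorem IsLag.skewForm_forall_degreeLT_iff {M N : ℕ} (hNM : N < M) {t : ℂ} (ht : t.im ≠ 0)
    {L : ℕ → ℂ[X]} (hL : IsLag M N L) {m : ℕ} (hne : skewForm hNM ht (L (m + 1)) (L m) ≠ 0)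
    (f : ℂ[X]) :
    (∀ p ∈ degreeLT ℂ (m + 2), skewForm hNM ht f p = 0) ↔
      (∀ q ∈ degreeLT ℂ m, innerForm hNM f q = 0) ∧ skewForm hNM ht f (L (m + 1)) = 0 ∧
        skewForm hNM ht f (L m) = 0 := by
  refine ⟨fun h => ⟨fun q hq => ?_, h _ (hL.mem_degreeLT (by omega)),
    h _ (hL.mem_degreeLT (by omega))⟩, fun ⟨h₁, h₂, h₃⟩ p hp => ?_⟩
  · rw [← skewForm_linTq hNM ht]
    exact h _ (linTq_mem_degreeLT M N t hq)
  · obtain ⟨q, hq, a, b, rfl⟩ := hL.exists_decomposition hNM ht hne hp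
    rw [map_add, map_add, map_smul, map_smul, skewForm_linTq, h₁ q hq, h₂, h₃]
    simp

theorem monic_natDegree_iff_sub_mem_degreeLT {p r : ℂ[X]} {n : ℕ} (hr : r.Monic)
    (hrn : r.natDegree = n) : (p.Monic ∧ p.natDegree = n) ↔ p - r ∈ degreeLT ℂ n := by
  have hrdeg : r.degree = n := by rw [degree_eq_natDegree hr.ne_zero, hrn]
  constructor
  · rintro ⟨hp, hpn⟩
    have hpdeg : p.degree = n := by rw [degree_eq_natDegree hp.ne_zero, hpn]
    rw [mem_degreeLT, ← hpdeg]
    exact degree_sub_lt_left (hpdeg.trans hrdeg.symm) hp.ne_zero (hp.trans hr.symm)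
  · intro h
    rw [mem_degreeLT, ← hrdeg] at h
    rw [← add_sub_cancel r p]
    exact ⟨hr.add_of_left h,
      (natDegree_eq_of_degree_eq (degree_add_eq_left_of_degree_lt h)).trans hrn⟩

/-- Fix `k ≥ 2` with `⟨L_{2k−1}, L_{2k−2}⟩₁ ≠ 0`.  Then (i) the
polynomial `π_{2k,1} = L_{2k} − (⟨L_{2k},L_{2k−2}⟩₁/⟨L_{2k−1},L_{2k−2}⟩₁)·L_{2k−1}` is
the unique monic polynomial of degree `2k` skew-orthogonal to `y^j` for
`j = 0,…,2k−1`; (ii) `⟨L_{2k}, L_{2k−1}⟩₁ = 0`; (iii) a monic polynomial `π` of degree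
`2k+1` is skew-orthogonal to `y^j` for `j = 0,…,2k−1` iff it has the stated form with an
arbitrary constant `c`. -/
theorem stmt_8 (M N : ℕ) (hN : 0 < N) (hNM : N < M) (t : ℂ) (ht : t.im ≠ 0)
    (L : ℕ → Polynomial ℂ) (hL : IsLag M N L)
    (k : ℕ) (hk : 2 ≤ k)
    (hne : skew1 M N t (L (2 * k - 1)) (L (2 * k - 2)) ≠ 0) :
    ∀ π2k : Polynomial ℂ,
      π2k = L (2 * k) -
          Polynomial.C (skew1 M N t (L (2 * k)) (L (2 * k - 2)) /
            skew1 M N t (L (2 * k - 1)) (L (2 * k - 2))) * L (2 * k - 1) →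
      (π2k.Monic ∧ π2k.natDegree = 2 * k ∧
        ∀ j, j < 2 * k → skew1 M N t π2k (Polynomial.X ^ j) = 0) ∧
      (∀ π : Polynomial ℂ, π.Monic → π.natDegree = 2 * k →
        (∀ j, j < 2 * k → skew1 M N t π (Polynomial.X ^ j) = 0) → π = π2k) ∧
      skew1 M N t (L (2 * k)) (L (2 * k - 1)) = 0 ∧
      (∀ π : Polynomial ℂ,
        (π.Monic ∧ π.natDegree = 2 * k + 1 ∧
            ∀ j, j < 2 * k → skew1 M N t π (Polynomial.X ^ j) = 0) ↔
          ∃ c : ℂ, π = L (2 * k + 1)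
            - Polynomial.C (skew1 M N t (L (2 * k + 1)) (L (2 * k - 2)) /
                skew1 M N t (L (2 * k - 1)) (L (2 * k - 2))) * L (2 * k - 1)
            + Polynomial.C (skew1 M N t (L (2 * k + 1)) (L (2 * k - 1)) /
                skew1 M N t (L (2 * k - 1)) (L (2 * k - 2))) * L (2 * k - 2)
            + Polynomial.C c * π2k) := by
  obtain ⟨j, rfl⟩ : ∃ j, k = j + 1 := ⟨k - 1, by omega⟩
  obtain ⟨m, hm⟩ : ∃ m, m = 2 * j := ⟨_, rfl⟩
  have hodd : Odd (m + 1) := ⟨j, by omega⟩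
  have e₁ : 2 * (j + 1) = m + 2 := by omega
  have e₂ : m + 2 - 1 = m + 1 := rfl
  have e₃ : m + 2 - 2 = m := rfl
  simp only [e₁, e₂, e₃, ← skewForm_apply hNM ht, ← smul_eq_C_mul] at hne ⊢
  intro p hp
  set S := skewForm hNM ht
  have hzero : S (L (m + 2)) (L (m + 1)) = 0 := hL.skewForm_succ_eq_zero hNM ht hodd
  have hself (f) : S f f = 0 := skewForm_self hNM ht f
  have hswap : S (L m) (L (m + 1)) = -S (L (m + 1)) (L m) := skewForm_swap hNM ht _ _
  have horth (f : ℂ[X]) : (∀ j, j < m + 2 → S f (X ^ j) = 0) ↔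
      (∀ q ∈ degreeLT ℂ m, innerForm hNM f q = 0) ∧ S f (L (m + 1)) = 0 ∧ S f (L m) = 0 :=
    (forall_degreeLT_iff_forall_X_pow (S f) (m + 2)).symm.trans
      (hL.skewForm_forall_degreeLT_iff hNM ht hne f)
  have hinner (i : ℕ) (q) (hq : q ∈ degreeLT ℂ m) : innerForm hNM (L (m + i)) q = 0 :=
    hL.innerForm_eq_zero hNM (degreeLT_le (Nat.le_add_right m i) hq)
  have hinner₀ := hinner 0
  have hinner₁ := hinner 1
  have hinner₂ := hinner 2
  have hinner₃ := hinner 3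
  rw [add_zero] at hinner₀
  set s := S (L (m + 1)) (L m)
  have hp_orth : ∀ j, j < m + 2 → S p (X ^ j) = 0 := by
    rw [horth, hp]
    refine ⟨fun q hq => ?_, ?_, ?_⟩
    · simp [hinner₁ q hq, hinner₂ q hq]
    · simp [hzero, hself]
    · simp only [map_sub, map_smul, LinearMap.sub_apply, LinearMap.smul_apply, smul_eq_mul]
      field_simp
      ring
  refine ⟨?_, ?_, hzero, fun f => ⟨?_, ?_⟩⟩
  · rw [← and_assoc, monic_natDegree_iff_sub_mem_degreeLT (hL (m + 2)).1 (hL (m + 2)).2.1]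
    refine ⟨?_, hp_orth⟩
    rw [hp, sub_sub_cancel_left]
    exact neg_mem (Submodule.smul_mem _ _ (hL.mem_degreeLT (by omega)))
  · intro f hf hfn hforth
    obtain ⟨h₁, h₂, h₃⟩ := (horth f).1 hforth
    obtain ⟨c, hc⟩ := hL.exists_eq_sum hNM (m := m) 2
      ((monic_natDegree_iff_sub_mem_degreeLT (hL (m + 2)).1 (hL (m + 2)).2.1).1 ⟨hf, hfn⟩)
      (fun q hq => by rw [map_sub, LinearMap.sub_apply, h₁ q hq, hinner₂ q hq, sub_zero])
    simp only [Finset.sum_range_succ, Finset.sum_range_zero, zero_add, add_zero] at hc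
    rw [sub_eq_iff_eq_add] at hc
    simp only [hc, map_add, map_smul, LinearMap.add_apply, LinearMap.smul_apply, smul_eq_mul,
      hswap, hself, hzero, mul_zero, add_zero, zero_add] at h₂ h₃
    have hc0 : c 0 = 0 := by simpa [hne, s] using h₂
    have hc1 : c 1 = -(S (L (m + 2)) (L m) / s) := by
      field_simp
      linear_combination h₃
    rw [hc, hp, hc0, hc1]
    module
  · rintro ⟨hf, hfn, hforth⟩
    obtain ⟨h₁, h₂, h₃⟩ := (horth f).1 hforth
    obtain ⟨c, hc⟩ := hL.exists_eq_sum hNM (m := m) 3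
      ((monic_natDegree_iff_sub_mem_degreeLT (hL (m + 3)).1 (hL (m + 3)).2.1).1 ⟨hf, hfn⟩)
      (fun q hq => by rw [map_sub, LinearMap.sub_apply, h₁ q hq, hinner₃ q hq, sub_zero])
    simp only [Finset.sum_range_succ, Finset.sum_range_zero, zero_add, add_zero] at hc
    rw [sub_eq_iff_eq_add] at hc
    simp only [hc, map_add, map_smul, LinearMap.add_apply, LinearMap.smul_apply, smul_eq_mul,
      hswap, hself, hzero, mul_zero, add_zero, zero_add] at h₂ h₃
    have hc0 : c 0 = S (L (m + 3)) (L (m + 1)) / s := by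
      field_simp
      linear_combination -h₂
    have hc1 : c 1 = -(S (L (m + 3)) (L m) / s) - c 2 * (S (L (m + 2)) (L m) / s) := by
      field_simp
      linear_combination h₃
    refine ⟨c 2, ?_⟩
    rw [hc, hp, hc0, hc1]
    module
  · rintro ⟨c, hf⟩
    rw [← and_assoc, monic_natDegree_iff_sub_mem_degreeLT (hL (m + 3)).1 (hL (m + 3)).2.1]
    constructor
    · have hmem : ∀ i < m + 3, L i ∈ degreeLT ℂ (m + 3) := fun i hi => hL.mem_degreeLT hi
      have hpmem : p ∈ degreeLT ℂ (m + 3) := by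
        rw [hp]
        exact sub_mem (hmem _ (by omega)) (Submodule.smul_mem _ _ (hmem _ (by omega)))
      rw [hf, add_assoc, sub_add, sub_sub_cancel_left]
      exact neg_mem (sub_mem (Submodule.smul_mem _ _ (hmem _ (by omega)))
        (add_mem (Submodule.smul_mem _ _ (hmem _ (by omega))) (Submodule.smul_mem _ _ hpmem)))
    · obtain ⟨h₁, h₂, h₃⟩ := (horth p).1 hp_orth
      rw [horth, hf]
      refine ⟨fun q hq => ?_, ?_, ?_⟩
      · simp [hinner₀ q hq, hinner₁ q hq, hinner₃ q hq, h₁ q hq]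
      · simp only [map_add, map_sub, map_smul, LinearMap.add_apply, LinearMap.sub_apply,
          LinearMap.smul_apply, smul_eq_mul, hswap, hself, h₂]
        field_simp
        ring
      · simp only [map_add, map_sub, map_smul, LinearMap.add_apply, LinearMap.sub_apply,
          LinearMap.smul_apply, smul_eq_mul, hself, h₃]
        field_simp
        ring
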